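/- arXiv:0706.1383 — 3 statements merged into one kernel-verified Lean document; each statement's English description precedes it below -/
import Mathlib

section
/- Let A be a nonempty compact convex subset of ℝⁿ and f : A → A any map. For p ∈ A define T_f(p) = {q ∈ A : there is a sequence (p_i) in A with p_i ≠ p, p_i → p, and f(p_i) → q}, with the convention T_f(p) = {p} when A = {p}. Then the graph {(p,q) : p ∈ A, q ∈ convexHull(T_f(p))} is a closed subset of A × A. -/
open Filter Topology Set

open Classical in
/-- The "continuoufication" `T_f(p)` of an arbitrary self map `f` of
`A ⊆ ℝⁿ`: all limits `q` of images `f(p_i)` of sequences `(p_i)` in `A` with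
`p_i ≠ p` and `p_i → p`, with the convention `T_f(p) = {p}` when `A = {p}`. -/
noncomputable def euclidTf {n : ℕ} (A : Set (EuclideanSpace ℝ (Fin n)))
    (f : EuclideanSpace ℝ (Fin n) → EuclideanSpace ℝ (Fin n))
    (p : EuclideanSpace ℝ (Fin n)) : Set (EuclideanSpace ℝ (Fin n)) :=
  if A = {p} then {p}
  else {q | q ∈ A ∧ ∃ s : ℕ → EuclideanSpace ℝ (Fin n),
    (∀ i, s i ∈ A) ∧ (∀ i, s i ≠ p) ∧ Tendsto s atTop (nhds p) ∧
      Tendsto (fun i => f (s i)) atTop (nhds q)}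

/-- The pairs `(p, q)` adherent to the graph of `f` over `A` with the point `p` removed
form a closed set. -/
lemma isClosed_setOf_mem_closure_graph_diff {X Y : Type*} [TopologicalSpace X] [T1Space X]
    [TopologicalSpace Y] (A : Set X) (f : X → Y) :
    IsClosed {x : X × Y | x ∈ closure ((fun s => (s, f s)) '' (A \ {x.1}))} := by
  refine isClosed_of_closure_subset fun x hx => mem_closure_iff.2 fun U hU hxU => ?_
  obtain ⟨y, hyU, hy⟩ := mem_closure_iff.1 hx U hU hxU
  rw [mem_ofPred_eq, mem_closure_iff] at hy
  by_cases hxy : y.1 = x.1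
  · rw [← hxy]
    exact hy U hU hyU
  · obtain ⟨_, ⟨hU', hne⟩, s, hs, rfl⟩ := hy (U ∩ Prod.fst ⁻¹' {x.1}ᶜ)
      (hU.inter (isOpen_compl_singleton.preimage continuous_fst)) ⟨hyU, hxy⟩
    exact ⟨_, hU', s, ⟨hs.1, hne⟩, rfl⟩

lemma mem_euclidTf_iff_mem_closure {n : ℕ} {A : Set (EuclideanSpace ℝ (Fin n))}
    {f : EuclideanSpace ℝ (Fin n) → EuclideanSpace ℝ (Fin n)}
    {p q : EuclideanSpace ℝ (Fin n)} (hA : A ≠ {p}) :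
    q ∈ euclidTf A f p ↔ q ∈ A ∧ (p, q) ∈ closure ((fun s => (s, f s)) '' (A \ {p})) := by
  rw [euclidTf, if_neg hA, mem_ofPred_eq, mem_closure_iff_seq_limit]
  refine and_congr_right fun _ => ⟨?_, ?_⟩
  · rintro ⟨s, hsA, hsp, hs, hfs⟩
    exact ⟨fun i => (s i, f (s i)), fun i => ⟨s i, ⟨hsA i, hsp i⟩, rfl⟩, hs.prodMk_nhds hfs⟩
  · rintro ⟨u, hu, hlim⟩
    choose s hs hsu using hu
    obtain rfl : (fun i => (s i, f (s i))) = u := funext hsu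
    exact ⟨s, fun i => (hs i).1, fun i => (hs i).2, hlim.fst_nhds, hlim.snd_nhds⟩

/-- **Carathéodory's theorem** with a fixed number of points, which may repeat. -/
lemma mem_convexHull_iff_exists_stdSimplex {E : Type*} [AddCommGroup E] [Module ℝ E]
    [FiniteDimensional ℝ E] {s : Set E} {x : E} :
    x ∈ convexHull ℝ s ↔ ∃ w ∈ stdSimplex ℝ (Fin (Module.finrank ℝ E + 1)),
      ∃ z : Fin (Module.finrank ℝ E + 1) → E, (∀ i, z i ∈ s) ∧ ∑ i, w i • z i = x := by
  constructor
  · intro hx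
    obtain ⟨ι, _, z, w, hz, hind, hw, hw1, rfl⟩ := eq_pos_convex_span_of_mem_convexHull hx
    obtain ⟨e⟩ : Nonempty (ι ↪ Fin (Module.finrank ℝ E + 1)) :=
      Function.Embedding.nonempty_of_card_le <| by
        simpa using hind.card_le_finrank_succ.trans
          (Nat.succ_le_succ (Submodule.finrank_le _))
    obtain ⟨a, ha⟩ := convexHull_nonempty_iff.1 ⟨_, hx⟩
    have hw' (i) (hi : i ∉ Set.range e) : Function.extend e w 0 i = 0 :=
      Function.extend_apply' _ _ _ hi
    refine ⟨Function.extend e w 0, ⟨fun i => ?_, ?_⟩, Function.extend e z fun _ => a,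
      fun i => ?_, ?_⟩
    · by_cases hi : i ∈ Set.range e
      · obtain ⟨j, rfl⟩ := hi
        simpa [e.injective.extend_apply] using (hw j).le
      · exact (hw' i hi).ge
    · rw [← hw1]
      exact (Fintype.sum_of_injective e e.injective _ _ hw'
        fun j => (e.injective.extend_apply ..).symm).symm
    · by_cases hi : i ∈ Set.range e
      · obtain ⟨j, rfl⟩ := hi
        rw [e.injective.extend_apply]
        exact hz ⟨j, rfl⟩
      · rwa [Function.extend_apply' _ _ _ hi]
    · refine (Fintype.sum_of_injective e e.injective _ _ (fun i hi => ?_) fun j => ?_).symm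
      · rw [hw' i hi, zero_smul]
      · rw [e.injective.extend_apply, e.injective.extend_apply]
  · rintro ⟨w, hw, z, hz, rfl⟩
    exact (convex_convexHull ℝ s).sum_mem (fun i _ => hw.1 i) hw.2
      fun i _ => subset_convexHull ℝ s (hz i)

/-- Fibrewise convex hulls of a compact relation in finite dimension form a compact relation. -/
lemma IsCompact.setOf_mem_convexHull {X E : Type*} [TopologicalSpace X] [T2Space X]
    [AddCommGroup E] [Module ℝ E] [FiniteDimensional ℝ E] [TopologicalSpace E] [T2Space E]
    [ContinuousAdd E] [ContinuousSMul ℝ E] {G : Set (X × E)} (hG : IsCompact G) :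
    IsCompact {x : X × E | x.2 ∈ convexHull ℝ {q | (x.1, q) ∈ G}} := by
  let ι := Fin (Module.finrank ℝ E + 1)
  have hK : IsCompact (((Prod.fst '' G) ×ˢ stdSimplex ℝ ι ×ˢ
      univ.pi fun _ : ι => Prod.snd '' G) ∩ ⋂ i, {t | (t.1, t.2.2 i) ∈ G}) :=
    ((hG.image continuous_fst).prod <| (isCompact_stdSimplex ℝ ι).prod <|
      isCompact_univ_pi fun _ => hG.image continuous_snd).inter_right <|
        isClosed_iInter fun i => hG.isClosed.preimage (by fun_prop)
  convert hK.image (f := fun t => (t.1, ∑ i, t.2.1 i • t.2.2 i)) (by fun_prop) using 1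
  ext ⟨p, q⟩
  simp only [mem_ofPred_eq, mem_convexHull_iff_exists_stdSimplex]
  constructor
  · rintro ⟨w, hw, z, hz, rfl⟩
    exact ⟨(p, w, z), ⟨⟨⟨_, hz 0, rfl⟩, hw, fun i _ => ⟨_, hz i, rfl⟩⟩, mem_iInter.2 hz⟩, rfl⟩
  · rintro ⟨⟨p, w, z⟩, ⟨⟨-, hw, -⟩, hz⟩, h⟩
    obtain ⟨rfl, rfl⟩ := Prod.mk.inj h
    exact ⟨w, hw, z, mem_iInter.1 hz, rfl⟩

/-- Finite-dimensional specialization of Lemma 3.2 (closedness of the graph):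
for `A` a nonempty compact convex subset of `ℝⁿ` and `f : A → A` any map, the
graph `{(p,q) : p ∈ A, q ∈ convexHull (T_f(p))}` is a closed subset of
`A × A`. -/
theorem isClosed_graph_convexHull_euclidTf {n : ℕ}
    (A : Set (EuclideanSpace ℝ (Fin n))) (hne : A.Nonempty)
    (hcomp : IsCompact A) (hconv : Convex ℝ A)
    (f : EuclideanSpace ℝ (Fin n) → EuclideanSpace ℝ (Fin n))
    (hf : Set.MapsTo f A A) :
    ∀ x ∈ closure {x : EuclideanSpace ℝ (Fin n) × EuclideanSpace ℝ (Fin n) |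
        x.1 ∈ A ∧ x.2 ∈ convexHull ℝ (euclidTf A f x.1)},
      x ∈ A ×ˢ A →
        x ∈ {x : EuclideanSpace ℝ (Fin n) × EuclideanSpace ℝ (Fin n) |
          x.1 ∈ A ∧ x.2 ∈ convexHull ℝ (euclidTf A f x.1)} := by
  intro x hx hxA
  by_cases hA : A = {x.1}
  · have hTf : {y : EuclideanSpace ℝ (Fin n) × EuclideanSpace ℝ (Fin n) |
        y.1 ∈ A ∧ y.2 ∈ convexHull ℝ (euclidTf A f y.1)} = {x} := by
      have hx2 : x.2 = x.1 := by
        have := hxA.2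
        rwa [hA] at this
      ext ⟨p, q⟩
      simp only [mem_ofPred_eq, mem_singleton_iff, Prod.ext_iff, hx2]
      rw [hA, mem_singleton_iff]
      refine and_congr_right fun hp => ?_
      rw [euclidTf, if_pos (by rw [hp]), convexHull_singleton, mem_singleton_iff, hp]
    rwa [hTf, closure_singleton, ← hTf] at hx
  · have hTf {p q : EuclideanSpace ℝ (Fin n)} (hp : p ∈ A) : q ∈ euclidTf A f p ↔
        q ∈ A ∧ (p, q) ∈ closure ((fun s => (s, f s)) '' (A \ {p})) :=
      mem_euclidTf_iff_mem_closure fun h => hA <| by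
        rw [h, singleton_eq_singleton_iff]
        exact (mem_singleton_iff.1 (h ▸ hxA.1)).symm
    have hG := ((hcomp.prod hcomp).inter_right
      (isClosed_setOf_mem_closure_graph_diff A f)).setOf_mem_convexHull.isClosed
    refine ⟨hxA.1, convexHull_mono (fun q hq => (hTf hxA.1).2 ⟨hq.1.2, hq.2⟩)
      (hG.closure_subset_iff.2 ?_ hx)⟩
    rintro ⟨p, q⟩ ⟨hp, hq⟩
    refine convexHull_mono (fun r hr => ?_) hq
    exact ⟨⟨hp, ((hTf hp).1 hr).1⟩, ((hTf hp).1 hr).2⟩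
end

section
/- Let A be a nonempty compact convex subset of ℝⁿ and f : A → A any map. For p ∈ A define T_f(p) = {q ∈ A : there is a sequence (p_i) in A with p_i ≠ p, p_i → p, and f(p_i) → q}, with the convention T_f(p) = {p} when A = {p}. Then there exists a point p* ∈ A such that p* ∈ convexHull(T_f(p*)). -/
open Filter Topology Set

/-- `det (1 + M)` is a fixed affine combination of `det (1 + t • M)` at more than `dim E` nodes `t`,
by Lagrange interpolation. -/
theorem exists_det_one_add_eq_sum (E : Type*) [AddCommGroup E] [Module ℝ E] [FiniteDimensional ℝ E]
    {s : Finset ℝ} (hs : Module.finrank ℝ E < s.card) :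
    ∃ c : ℝ → ℝ, ∑ t ∈ s, c t = 1 ∧
      ∀ M : E →ₗ[ℝ] E, LinearMap.det (1 + M) = ∑ t ∈ s, c t * LinearMap.det (1 + t • M) := by
  classical
  have hinj : InjOn (id : ℝ → ℝ) s := injOn_id _
  have hne : s.Nonempty := Finset.card_pos.mp (by lia)
  refine ⟨fun t => (Lagrange.basis s id t).eval 1, ?_, fun M => ?_⟩
  · rw [← Polynomial.eval_finsetSum, Lagrange.sum_basis hinj hne, Polynomial.eval_one]
  · set b := Module.finBasis ℝ E
    set A := LinearMap.toMatrix b b M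
    set P : Polynomial ℝ :=
      ((Polynomial.X : Polynomial ℝ) • A.map Polynomial.C + Matrix.map 1 Polynomial.C).det
    have heval (t : ℝ) : P.eval t = LinearMap.det (1 + t • M) := by
      rw [← LinearMap.det_toMatrix b, ← Polynomial.coe_evalRingHom, RingHom.map_det]
      congr 1
      ext i j
      by_cases h : i = j <;>
        simp [A, h, LinearMap.toMatrix_one, add_comm] <;> ring
    have hdeg : P.degree < s.card := by
      refine Polynomial.degree_le_natDegree.trans_lt ?_
      have := Polynomial.natDegree_det_X_add_C_le A 1
      rw [Fintype.card_fin] at this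
      exact_mod_cast this.trans_lt hs
    have := congrArg (Polynomial.eval 1) (Lagrange.eq_interpolate hinj hdeg)
    rw [Lagrange.interpolate_apply, Polynomial.eval_finsetSum, heval, one_smul] at this
    simpa [heval, mul_comm] using this

theorem ContinuousLinearMap.det_one_add_pos {E : Type*} [NormedAddCommGroup E] [NormedSpace ℝ E]
    [FiniteDimensional ℝ E] {N : E →L[ℝ] E} (hN : ‖N‖ < 1) : 0 < (1 + N).det := by
  have hne : ∀ s ∈ Icc (0 : ℝ) 1, (1 + s • N).det ≠ 0 := by
    intro s hs h0
    obtain ⟨v, hv, hv0⟩ := (Submodule.ne_bot_iff _).mp (LinearMap.bot_lt_ker_of_det_eq_zero h0).ne'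
    have h1 : v + s • N v = 0 := by simpa using hv
    have h2 : ‖v‖ = s * ‖N v‖ := by
      rw [eq_neg_of_add_eq_zero_left h1, norm_neg, norm_smul, Real.norm_of_nonneg hs.1,
        ← eq_neg_of_add_eq_zero_left h1]
    have h3 := N.le_opNorm v
    have h4 : 0 < ‖v‖ := norm_pos_iff.mpr hv0
    nlinarith [hs.2, norm_nonneg (N v)]
  by_contra! h
  have hc : ContinuousOn (fun s : ℝ => (1 + s • N).det) (Icc 0 1) :=
    (ContinuousLinearMap.continuous_det.comp (by fun_prop)).continuousOn
  obtain ⟨s, hs, hs0⟩ := intermediate_value_Icc' zero_le_one hc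
    (show (0 : ℝ) ∈ Icc _ _ by
      refine ⟨by simpa using h, ?_⟩
      simp [ContinuousLinearMap.det])
  exact hne s hs hs0

theorem image_ball_of_lipschitz {E : Type*} [NormedAddCommGroup E] [NormedSpace ℝ E]
    [CompleteSpace E] {w : E → E} {C : NNReal} (hw : LipschitzWith C w) {R : ℝ}
    (hout : ∀ x, x ∉ Metric.ball 0 R → w x = 0) {t : ℝ} (ht : 0 ≤ t) (htC : t * C < 1) :
    InjOn (fun x => x + t • w x) (Metric.ball 0 R) ∧
      (fun x => x + t • w x) '' Metric.ball 0 R = Metric.ball 0 R := by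
  set F : E → E := fun x => x + t • w x with hF
  have happ : ApproximatesLinearOn F (ContinuousLinearEquiv.refl ℝ E : E →L[ℝ] E) univ
      (t.toNNReal * C) := by
    intro x _ y _
    have h : F x - F y - (x - y) = t • (w x - w y) := by simp only [hF, smul_sub]; abel
    have hle := mul_le_mul_of_nonneg_left (hw.norm_sub_le x y) ht
    simpa [h, norm_smul, ht, abs_of_nonneg ht, mul_assoc] using hle
  have hc : Subsingleton E ∨
      t.toNNReal * C < ‖((ContinuousLinearEquiv.refl ℝ E).symm : E →L[ℝ] E)‖₊⁻¹ := by
    cases subsingleton_or_nontrivial E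
    · left; assumption
    · right
      rw [← NNReal.coe_lt_coe]
      simpa [ht] using htC
  have hinj : F.Injective := fun x y hxy =>
    congrArg Subtype.val (happ.injective hc (a₁ := ⟨x, mem_univ x⟩) (a₂ := ⟨y, mem_univ y⟩) hxy)
  have hsurj := happ.surjective hc
  have hfix {x : E} (hx : x ∉ Metric.ball 0 R) : F x = x := by simp [hF, hout x hx]
  refine ⟨hinj.injOn, Subset.antisymm ?_ fun y hy => ?_⟩
  · rintro _ ⟨x, hx, rfl⟩
    by_contra h
    exact h (by rwa [hinj (hfix h)])
  · obtain ⟨x, rfl⟩ := hsurj y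
    by_contra h
    exact h ⟨x, by by_contra hx; exact hx (by rwa [hfix hx] at hy), rfl⟩

theorem IsCompact.convexHull {E : Type*} [NormedAddCommGroup E] [NormedSpace ℝ E]
    [FiniteDimensional ℝ E] {K : Set E} (hK : IsCompact K) : IsCompact (convexHull ℝ K) := by
  have key : _root_.convexHull ℝ K = ⋃ m ∈ Iic (Module.finrank ℝ E + 1),
      (fun q : (Fin m → ℝ) × (Fin m → E) => ∑ i, q.1 i • q.2 i) ''
        (stdSimplex ℝ (Fin m) ×ˢ univ.pi fun _ => K) := by
    refine Subset.antisymm (fun x hx => ?_) ?_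
    · obtain ⟨ι, _, z, c, hz, haff, hc, hc1, rfl⟩ := eq_pos_convex_span_of_mem_convexHull hx
      have e := (Fintype.equivFin ι).symm
      refine mem_iUnion₂.mpr ⟨Fintype.card ι, ?_, (c ∘ e, z ∘ e),
        ⟨⟨fun i => (hc _).le, ?_⟩, fun i _ => hz (mem_range_self _)⟩, ?_⟩
      · exact haff.card_le_finrank_succ.trans
          (Nat.succ_le_succ (Submodule.finrank_le _))
      · exact (e.sum_comp c).trans hc1
      · exact e.sum_comp fun i => c i • z i
    · refine iUnion₂_subset fun m _ => ?_
      rintro _ ⟨⟨c, z⟩, ⟨hc, hz⟩, rfl⟩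
      exact (convex_convexHull ℝ K).sum_mem (fun i _ => hc.1 i) hc.2
        fun i _ => subset_convexHull ℝ K (hz i (mem_univ i))
  rw [key]
  refine (finite_Iic _).isCompact_biUnion fun m _ => ?_
  refine ((isCompact_stdSimplex ℝ (Fin m)).prod (isCompact_univ_pi fun _ => hK)).image ?_
  fun_prop

theorem lipschitzWith_of_lipschitzOnWith_closedBall {E F : Type*} [NormedAddCommGroup E]
    [NormedSpace ℝ E] [NormedAddCommGroup F] {w : E → F} {C : NNReal} {R : ℝ}
    (hw : LipschitzOnWith C w (Metric.closedBall 0 R))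
    (hout : ∀ x, x ∉ Metric.ball 0 R → w x = 0) : LipschitzWith C w := by
  have key : ∀ x ∈ Metric.ball (0 : E) R, ∀ y ∉ Metric.ball (0 : E) R,
      dist (w x) (w y) ≤ C * dist x y := by
    intro x hx y hy
    have hx' : ‖x‖ < R := by simpa using hx
    have hy' : R ≤ ‖y‖ := by simpa using hy
    obtain ⟨z, hz, hzR⟩ := (convex_segment x y).isPreconnected.intermediate_value
      (left_mem_segment ℝ x y) (right_mem_segment ℝ x y) continuous_norm.continuousOn
      ⟨hx'.le, hy'⟩
    have h0 : w y = w z := by rw [hout y hy, hout z (by simp [hzR])]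
    rw [h0]
    refine (hw.dist_le_mul x (Metric.ball_subset_closedBall hx) z (by simp [hzR])).trans ?_
    gcongr
    linarith [dist_add_dist_of_mem_segment hz, dist_nonneg (x := z) (y := y)]
  refine .of_dist_le_mul fun x y => ?_
  by_cases hx : x ∈ Metric.ball 0 R <;> by_cases hy : y ∈ Metric.ball 0 R
  · exact hw.dist_le_mul x (Metric.ball_subset_closedBall hx) y (Metric.ball_subset_closedBall hy)
  · exact key x hx y hy
  · rw [dist_comm, dist_comm x]
    exact key y hy x hx
  · rw [hout x hx, hout y hy, dist_self]
    positivity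

/-- There is no Lipschitz retraction of the ball onto its boundary sphere that is differentiable in
the interior (Milnor-Rogers volume argument). -/
theorem not_forall_norm_add_eq_of_lipschitz {E : Type*} [NormedAddCommGroup E]
    [InnerProductSpace ℝ E] [FiniteDimensional ℝ E] {w : E → E} {C : NNReal}
    (hw : LipschitzWith C w) {R : ℝ} (hR : 0 < R)
    (hout : ∀ x, x ∉ Metric.ball 0 R → w x = 0)
    (hdiff : ∀ x ∈ Metric.ball 0 R, DifferentiableAt ℝ w x) :
    ¬ ∀ x ∈ Metric.ball 0 R, ‖x + w x‖ = R := by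
  intro hnorm
  borelize E
  let μ : MeasureTheory.Measure E := MeasureTheory.volume
  set B : Set E := Metric.ball 0 R
  obtain ⟨s, hsub, hcard⟩ := (Ioo_infinite (show (0 : ℝ) < ((C : ℝ) + 1)⁻¹ by positivity)
    ).exists_subset_card_eq (Module.finrank ℝ E + 1)
  obtain ⟨c, hc, hdet⟩ := exists_det_one_add_eq_sum E (s := s) (by lia)
  have hjac : ∀ t ∈ s, MeasureTheory.IntegrableOn
      (fun x => LinearMap.det (1 + t • (fderiv ℝ w x : E →ₗ[ℝ] E))) B μ ∧
      ∫ x in B, LinearMap.det (1 + t • (fderiv ℝ w x : E →ₗ[ℝ] E)) ∂μ = μ.real B := by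
    intro t hts
    obtain ⟨ht, ht'⟩ := hsub hts
    have htC : t * C < 1 := by
      have h1 : t * (C + 1) < 1 := by
        rwa [← one_div, lt_div_iff₀ (by positivity)] at ht'
      linarith
    obtain ⟨hinj, himg⟩ := image_ball_of_lipschitz hw hout ht.le htC
    have hderiv : ∀ x ∈ B, HasFDerivWithinAt (fun x => x + t • w x)
        (1 + t • fderiv ℝ w x) B x := fun x hx =>
      ((hasFDerivAt_id x).add ((hdiff x hx).hasFDerivAt.const_smul t)).hasFDerivWithinAt
    have hpos : ∀ x ∈ B, |(1 + t • fderiv ℝ w x).det| • (1 : ℝ)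
        = LinearMap.det (1 + t • (fderiv ℝ w x : E →ₗ[ℝ] E)) := by
      intro x _
      have hlt : ‖t • fderiv ℝ w x‖ < 1 := by
        rw [norm_smul, Real.norm_of_nonneg ht.le]
        exact (mul_le_mul_of_nonneg_left (norm_fderiv_le_of_lipschitz ℝ hw) ht.le).trans_lt htC
      rw [abs_of_pos (ContinuousLinearMap.det_one_add_pos hlt), smul_eq_mul, mul_one]
      rfl
    have hB : MeasurableSet B := measurableSet_ball
    refine ⟨?_, ?_⟩
    · refine MeasureTheory.IntegrableOn.congr_fun ?_ hpos hB
      refine (MeasureTheory.integrableOn_image_iff_integrableOn_abs_det_fderiv_smul μ hB hderiv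
        hinj fun _ => (1 : ℝ)).mp ?_
      rw [himg]
      exact MeasureTheory.integrableOn_const (MeasureTheory.measure_ball_lt_top.ne)
    · rw [← MeasureTheory.setIntegral_congr_fun hB hpos,
        ← MeasureTheory.integral_image_eq_integral_abs_det_fderiv_smul μ hB hderiv hinj
          fun _ => (1 : ℝ), himg]
      simp [B]
  have hzero : ∀ x ∈ B, LinearMap.det (1 + (fderiv ℝ w x : E →ₗ[ℝ] E)) = 0 := by
    intro x hx
    by_contra hne
    have hder : HasFDerivAt (fun x => x + w x) (1 + fderiv ℝ w x) x :=
      (hasFDerivAt_id x).add (hdiff x hx).hasFDerivAt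
    have hconst : HasFDerivAt (fun x => ‖x + w x‖ ^ 2) (0 : E →L[ℝ] ℝ) x :=
      (hasFDerivAt_const (R ^ 2) x).congr_of_eventuallyEq <| by
        filter_upwards [Metric.isOpen_ball.mem_nhds hx] with y hy
        rw [hnorm y hy]
    obtain ⟨v, hv⟩ := (LinearMap.equivOfDetNeZero _ hne).surjective (x + w x)
    have h := congrArg (fun L : E →L[ℝ] ℝ => L v) (hder.norm_sq.unique hconst)
    have hv' : (1 + fderiv ℝ w x) v = x + w x := hv
    have h' : 2 * (inner ℝ (x + w x) ((1 + fderiv ℝ w x) v)) = 0 := by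
      simpa [inner_add_left, inner_add_right, mul_add] using h
    rw [hv', real_inner_self_eq_norm_sq, hnorm x hx] at h'
    nlinarith
  have hvol : ∫ x in B, LinearMap.det (1 + (fderiv ℝ w x : E →ₗ[ℝ] E)) ∂μ = μ.real B := by
    rw [MeasureTheory.integral_congr_ae (.of_forall fun x => hdet _),
      MeasureTheory.integral_finsetSum _ fun t ht => (hjac t ht).1.const_mul (c t)]
    simp_rw [MeasureTheory.integral_const_mul]
    rw [Finset.sum_congr rfl fun t ht => by rw [(hjac t ht).2], ← Finset.sum_mul, hc, one_mul]
  rw [MeasureTheory.setIntegral_congr_fun measurableSet_ball hzero] at hvol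
  have : 0 < μ.real B :=
    ENNReal.toReal_pos (Metric.measure_ball_pos μ 0 hR).ne' MeasureTheory.measure_ball_lt_top.ne
  simp at hvol
  linarith

/-- **Brouwer's fixed point theorem** for `C¹` maps with bounded range. -/
theorem exists_fixed_point_of_contDiff {E : Type*} [NormedAddCommGroup E]
    [InnerProductSpace ℝ E] [FiniteDimensional ℝ E] {g : E → E} (hg : ContDiff ℝ 1 g) {R : ℝ}
    (hgR : ∀ x, ‖g x‖ < R) : ∃ x, g x = x := by
  by_contra! hne
  have hR : 0 < R := (norm_nonneg _).trans_lt (hgR 0)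
  let v : E → E := fun x => x - g x
  have hv0 (x : E) : v x ≠ 0 := sub_ne_zero.mpr (hne x).symm
  have hvpos (x : E) : 0 < ‖v x‖ ^ 2 := by have := norm_pos_iff.mpr (hv0 x); positivity
  have hv : ContDiff ℝ 1 v := contDiff_id.sub hg
  let D : E → ℝ := fun x => inner ℝ x (v x) ^ 2 + ‖v x‖ ^ 2 * (R ^ 2 - ‖x‖ ^ 2)
  have hD : ContDiff ℝ 1 D := by
    unfold D
    exact ((contDiff_id.inner ℝ hv).pow 2).add
      ((hv.norm_sq ℝ).mul (contDiff_const.sub (contDiff_id.norm_sq ℝ)))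
  have hsphere {x : E} (hx : ‖x‖ = R) : 0 < inner ℝ x (v x) := by
    have h1 : inner ℝ x (v x) = R ^ 2 - inner ℝ x (g x) := by
      simp [v, inner_sub_right, hx]
    have h2 := real_inner_le_norm x (g x)
    rw [hx] at h2
    nlinarith [hgR x]
  have hDpos {x : E} (hx : x ∈ Metric.closedBall 0 R) : 0 < D x := by
    rcases (mem_closedBall_zero_iff.mp hx).lt_or_eq with h | h
    · have : 0 < R ^ 2 - ‖x‖ ^ 2 := by nlinarith [norm_nonneg x]
      have := mul_pos (hvpos x) this
      unfold D
      positivity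
    · have := hsphere h
      simp only [D, h, sub_self, mul_zero, add_zero]
      positivity
  let l : E → ℝ := fun x => (√(D x) - inner ℝ x (v x)) / ‖v x‖ ^ 2
  have hl (x : E) (hx : x ∈ Metric.closedBall 0 R) : ContDiffAt ℝ 1 (fun x => l x • v x) x := by
    refine ContDiffAt.smul (ContDiffAt.div ?_ (hv.norm_sq ℝ).contDiffAt (hvpos x).ne') hv.contDiffAt
    exact (hD.contDiffAt.sqrt (hDpos hx).ne').sub (contDiff_id.inner ℝ hv).contDiffAt
  have hl_sphere {x : E} (hx : ‖x‖ = R) : l x = 0 := by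
    simp [l, D, hx, Real.sqrt_sq (hsphere hx).le]
  have hl_norm {x : E} (hx : x ∈ Metric.closedBall 0 R) : ‖x + l x • v x‖ = R := by
    rw [← sq_eq_sq₀ (norm_nonneg _) hR.le, norm_add_sq_real, norm_smul, mul_pow, inner_smul_right,
      Real.norm_eq_abs, sq_abs]
    have h1 := Real.sq_sqrt (hDpos hx).le
    have h2 : l x * ‖v x‖ ^ 2 = √(D x) - inner ℝ x (v x) := div_mul_cancel₀ _ (hvpos x).ne'
    refine mul_right_cancel₀ (hvpos x).ne' ?_
    have h3 : √(D x) = l x * ‖v x‖ ^ 2 + inner ℝ x (v x) := by linarith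
    have h4 : D x = inner ℝ x (v x) ^ 2 + ‖v x‖ ^ 2 * (R ^ 2 - ‖x‖ ^ 2) := rfl
    rw [h3, h4] at h1
    linear_combination h1
  obtain ⟨C, hC⟩ := ContDiffOn.exists_lipschitzOnWith
    (fun x hx => (hl x hx).contDiffWithinAt) one_ne_zero (convex_closedBall (0 : E) R)
    (isCompact_closedBall 0 R)
  let w : E → E := (Metric.ball 0 R).indicator fun x => l x • v x
  have hwl : ∀ x ∈ Metric.closedBall 0 R, w x = l x • v x := by
    intro x hx
    by_cases h : x ∈ Metric.ball 0 R
    · exact indicator_of_mem h _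
    · have : ‖x‖ = R := le_antisymm (by simpa using hx) (by simpa using h)
      simp [w, this, hl_sphere this]
  have hout : ∀ x, x ∉ Metric.ball 0 R → w x = 0 := fun x hx => indicator_of_notMem hx _
  refine not_forall_norm_add_eq_of_lipschitz
    (lipschitzWith_of_lipschitzOnWith_closedBall (C := C) (fun x hx y hy => ?_) hout) hR hout
    (fun x hx => ?_) fun x hx => ?_
  · rw [hwl x hx, hwl y hy]
    exact hC hx hy
  · have hx' := Metric.ball_subset_closedBall hx
    refine ((hl x hx').differentiableAt one_ne_zero).congr_of_eventuallyEq ?_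
    filter_upwards [Metric.isOpen_ball.mem_nhds hx] with y hy
    exact hwl y (Metric.ball_subset_closedBall hy)
  · rw [hwl x (Metric.ball_subset_closedBall hx)]
    exact hl_norm (Metric.ball_subset_closedBall hx)

theorem exists_mem_convexHull_image_of_finite {E : Type*} [NormedAddCommGroup E]
    [InnerProductSpace ℝ E] [FiniteDimensional ℝ E] {A : Set E} (hcomp : IsCompact A)
    (hconv : Convex ℝ A) (hnt : A.Nontrivial) {f : E → E} (hf : MapsTo f A A) {P : Set E}
    (hP : P.Finite) {δ : ℝ} (hδ : 0 < δ) :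
    ∃ y ∈ A, y ∈ convexHull ℝ (f '' ((A \ P) ∩ Metric.ball y δ)) := by
  obtain ⟨a₀, ha₀⟩ := hnt.nonempty
  let U : Option ↥(A \ P) → Set E := fun i => i.elim Aᶜ fun x => Metric.ball x δ
  let c : Option ↥(A \ P) → E := fun i => i.elim a₀ fun x => f x
  have hUo : ∀ i, IsOpen (U i) := by
    rintro (_ | x)
    exacts [hcomp.isClosed.isOpen_compl, Metric.isOpen_ball]
  have hcA : ∀ i, c i ∈ A := by
    rintro (_ | x)
    exacts [ha₀, hf x.2.1]
  have hcover : univ ⊆ ⋃ i, U i := by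
    intro a _
    by_cases ha : a ∉ A
    · exact mem_iUnion.mpr ⟨none, ha⟩
    rw [not_not] at ha
    have hinf : (Metric.ball a δ ∩ A).Infinite := .of_accPt
      ((hconv.isPreconnected.preperfect_of_nontrivial hnt a ha).nhds_inter
        (Metric.ball_mem_nhds a hδ))
    obtain ⟨x, hx, hxP⟩ := (hinf.sdiff hP).nonempty
    exact mem_iUnion.mpr ⟨some ⟨x, hx.2, hxP⟩, Metric.mem_ball_comm.mp hx.1⟩
  obtain ⟨φ, hφ⟩ := SmoothPartitionOfUnity.exists_isSubordinate (modelWithCornersSelf ℝ E)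
    isClosed_univ U hUo hcover
  let g : E → E := fun y => ∑ᶠ i, φ i y • c i
  have hg : ContDiff ℝ 1 g :=
    (φ.contMDiff_finsum_smul fun _ _ _ => contMDiffAt_const).contDiff
  have hgA : ∀ y, g y ∈ A := fun y =>
    φ.finsum_smul_mem_convex (g := fun i _ => c i) (mem_univ y) (fun i _ => hcA i) hconv
  obtain ⟨R, hR⟩ := hcomp.isBounded.subset_ball 0
  obtain ⟨y, hy⟩ := exists_fixed_point_of_contDiff hg fun x => by simpa using hR (hgA x)
  have hyA : y ∈ A := hy ▸ hgA y
  refine ⟨y, hyA, ?_⟩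
  suffices h : g y ∈ convexHull ℝ (f '' ((A \ P) ∩ Metric.ball y δ)) by rwa [hy] at h
  refine φ.finsum_smul_mem_convex (g := fun i _ => c i) (mem_univ y) (fun i hi => ?_)
    (convex_convexHull ℝ _)
  have hyU : y ∈ U i := hφ i (subset_tsupport _ hi)
  rcases i with _ | x
  · exact absurd hyA hyU
  · exact subset_convexHull ℝ _ ⟨x, ⟨x.2, Metric.mem_ball_comm.mp hyU⟩, rfl⟩

theorem exists_nhds_separation_of_notMem_convexHull {E : Type*} [NormedAddCommGroup E]
    [NormedSpace ℝ E] [FiniteDimensional ℝ E] {A : Set E} (hcomp : IsCompact A) {f : E → E}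
    (hf : MapsTo f A A) {p : E}
    (hp : p ∉ convexHull ℝ {q | MapClusterPt q (𝓝[A \ {p}] p) f}) :
    ∃ U ∈ 𝓝 p, ∃ (l : E →L[ℝ] ℝ) (u : ℝ), ∀ y ∈ U, l y < u ∧ (y ∈ A \ {p} → u < l (f y)) := by
  have hmem : ∀ᶠ x in 𝓝[A \ {p}] p, f x ∈ A :=
    eventually_mem_nhdsWithin.mono fun x hx => hf hx.1
  have hcl : IsClosed {q | MapClusterPt q (𝓝[A \ {p}] p) f} := isClosed_setOfPred_clusterPt
  have hsub : {q | MapClusterPt q (𝓝[A \ {p}] p) f} ⊆ A := fun q hq =>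
    hcomp.isClosed.mem_of_mapClusterPt hq hmem
  obtain ⟨l, u, hlp, hl⟩ := geometric_hahn_banach_point_closed (convex_convexHull ℝ _)
    (hcomp.of_isClosed_subset hcl hsub).convexHull.isClosed hp
  have hev : ∀ᶠ x in 𝓝[A \ {p}] p, u < l (f x) := by
    by_contra h
    have hfreq : ∃ᶠ x in 𝓝[A \ {p}] p, f x ∈ A ∩ {z | l z ≤ u} :=
      ((not_eventually.mp h).and_eventually hmem).mono fun x hx => ⟨hx.2, not_lt.mp hx.1⟩
    obtain ⟨q, hq, hqc⟩ := (hcomp.inter_right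
      (isClosed_le l.continuous continuous_const)).exists_mapClusterPt_of_frequently hfreq
    exact (hl q (subset_convexHull ℝ _ hqc)).not_ge hq.2
  refine ⟨_, ((l.continuous.tendsto p).eventually_lt_const hlp).and
    (eventually_nhdsWithin_iff.mp hev), l, u, fun y hy => hy⟩

theorem setOf_mapClusterPt_subset_euclidTf {n : ℕ} {A : Set (EuclideanSpace ℝ (Fin n))}
    (hA : IsClosed A) {f : EuclideanSpace ℝ (Fin n) → EuclideanSpace ℝ (Fin n)}
    (hf : MapsTo f A A) (p : EuclideanSpace ℝ (Fin n)) :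
    {q | MapClusterPt q (𝓝[A \ {p}] p) f} ⊆ euclidTf A f p := by
  intro q hq
  have hqA : q ∈ A := hA.mem_of_mapClusterPt hq
    (eventually_mem_nhdsWithin.mono fun x hx => hf hx.1)
  unfold euclidTf
  split_ifs with h
  · rwa [h] at hqA
  · have : (𝓝[A \ {p}] p ⊓ comap f (𝓝 q)).NeBot := by
      rw [neBot_inf_comap_iff_map, inf_comm]
      exact hq
    obtain ⟨s, hs⟩ := exists_seq_tendsto (𝓝[A \ {p}] p ⊓ comap f (𝓝 q))
    rw [tendsto_inf, tendsto_comap_iff] at hs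
    obtain ⟨hsp, hsA⟩ := tendsto_nhdsWithin_iff.mp hs.1
    obtain ⟨N, hN⟩ := eventually_atTop.mp hsA
    refine ⟨hqA, fun i => s (i + N), fun i => (hN _ (by lia)).1, fun i => (hN _ (by lia)).2,
      hsp.comp (tendsto_add_atTop_nat N), hs.2.comp (tendsto_add_atTop_nat N)⟩

/-- Finite-dimensional specialization of Lemma 3.2 (via Kakutani's fixed point
theorem): for `A` a nonempty compact convex subset of `ℝⁿ` and `f : A → A` any
map, there is a point `p* ∈ A` with `p* ∈ convexHull (T_f(p*))`. -/
theorem exists_mem_convexHull_euclidTf {n : ℕ}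
    (A : Set (EuclideanSpace ℝ (Fin n))) (hne : A.Nonempty)
    (hcomp : IsCompact A) (hconv : Convex ℝ A)
    (f : EuclideanSpace ℝ (Fin n) → EuclideanSpace ℝ (Fin n))
    (hf : Set.MapsTo f A A) :
    ∃ pstar ∈ A, pstar ∈ convexHull ℝ (euclidTf A f pstar) := by
  rcases hne.exists_eq_singleton_or_nontrivial with ⟨a, rfl⟩ | hnt
  · exact ⟨a, rfl, by simp [euclidTf]⟩
  by_contra! hcon
  have hsep (p : EuclideanSpace ℝ (Fin n)) : ∃ U : Set (EuclideanSpace ℝ (Fin n)), p ∈ A →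
      U ∈ 𝓝 p ∧ ∃ (l : EuclideanSpace ℝ (Fin n) →L[ℝ] ℝ) (u : ℝ), ∀ y ∈ U, l y < u ∧
        (y ∈ A \ {p} → u < l (f y)) := by
    by_cases hp : p ∈ A
    · obtain ⟨U, hU, h⟩ := exists_nhds_separation_of_notMem_convexHull hcomp hf fun h =>
        hcon p hp (convexHull_mono (setOf_mapClusterPt_subset_euclidTf hcomp.isClosed hf p) h)
      exact ⟨U, fun _ => ⟨hU, h⟩⟩
    · exact ⟨∅, fun h => absurd h hp⟩
  choose U hU using hsep
  obtain ⟨t, htA, ht⟩ := hcomp.elim_nhds_subcover (fun p => interior (U p))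
    fun p hp => interior_mem_nhds.mpr (hU p hp).1
  obtain ⟨δ, hδ, hball⟩ := lebesgue_number_lemma_of_metric hcomp
    (c := fun p : t => interior (U p)) (fun _ => isOpen_interior) (by simpa [iUnion_subtype] using ht)
  obtain ⟨y, hyA, hy⟩ := exists_mem_convexHull_image_of_finite hcomp hconv hnt hf
    t.finite_toSet hδ
  obtain ⟨⟨p, hpt⟩, hp⟩ := hball y hyA
  obtain ⟨l, u, hlu⟩ := (hU p (htA p hpt)).2
  have hlt := (hlu y (interior_subset (hp (Metric.mem_ball_self hδ)))).1
  have hsub : f '' ((A \ t) ∩ Metric.ball y δ) ⊆ {z | u < l z} := by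
    rintro _ ⟨x, ⟨⟨hxA, hxt⟩, hx⟩, rfl⟩
    exact (hlu x (interior_subset (hp hx))).2 ⟨hxA, fun h => hxt (h ▸ hpt)⟩
  exact hlt.not_gt (convexHull_min hsub (convex_halfSpace_gt l.isLinear u) hy)
end

section
/- Let A be a compact convex subset of ℝⁿ containing at least two points and let f : A → A be any map. Define the measure of discontinuity d(f) = sup_{p∈A} inf_{δ>0} sup{‖f(p) - f(q)‖ : q ∈ A, 0 < ‖q - p‖ < δ}. Then there exists a point p* ∈ A such that ‖f(p*) - p*‖ ≤ d(f). -/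
open Filter Topology Set

/-- A finite set `S` is dominant for a family of utilities `u i` if no point is
strictly better than the worst element of `S` for all utilities at once. -/
def IsDominant {I α β : Type*} [LinearOrder β] (u : I → α → β) (S : Finset α) : Prop :=
  ∀ y, ∃ i, ∀ x ∈ S, u i y ≤ u i x

theorem IsDominant.mono {I α β : Type*} [LinearOrder β] {u : I → α → β} {S T : Finset α}
    (hS : IsDominant u S) (h : T ⊆ S) : IsDominant u T := fun y ↦
  (hS y).imp fun _ hi x hx ↦ hi x (h hx)

/-- `x` maximizes `u k` among the points exceeding the threshold `m l` for every `u l`, `l ≠ k`. -/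
def IsBestAbove {I α β : Type*} [LinearOrder β] (u : I → α → β) (m : I → α) (k : I) (x : α) :
    Prop :=
  (∀ l, l ≠ k → u l (m l) < u l x) ∧
    ∀ y, (∀ l, l ≠ k → u l (m l) < u l y) → u k y ≤ u k x

theorem IsBestAbove.eq {I α β : Type*} [LinearOrder β] {u : I → α → β}
    (hu : ∀ i, Function.Injective (u i)) {m : I → α} {k : I} {x y : α}
    (hx : IsBestAbove u m k x) (hy : IsBestAbove u m k y) : x = y :=
  hu k (le_antisymm (hy.2 x hx.1) (hx.2 y hy.1))

theorem exists_isBestAbove {I α β : Type*} [LinearOrder β] [Finite α] {u : I → α → β}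
    {m : I → α} {k : I} {y : α} (hy : ∀ l, l ≠ k → u l (m l) < u l y) :
    ∃ x, IsBestAbove u m k x := by
  obtain ⟨x, hx, hmax⟩ := Set.exists_max_image {y | ∀ l, l ≠ k → u l (m l) < u l y} (u k)
    (Set.toFinite _) ⟨y, hy⟩
  exact ⟨x, hx, hmax⟩

/-- The points extending a dominant set of cardinality `|I| - 1` to a dominant set of
cardinality `|I|` are described by two distinguished indices. -/
theorem IsDominant.exists_insert_iff {I α β : Type*} [LinearOrder β] [Fintype I] [DecidableEq α]
    {u : I → α → β} (hu : ∀ i, Function.Injective (u i)) {τ : Finset α}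
    (hτ : IsDominant u τ) (hcard : τ.card + 1 = Fintype.card I) {m : I → α}
    (hmτ : ∀ i, m i ∈ τ) (hm : ∀ i, ∀ x ∈ τ, u i (m i) ≤ u i x) :
    ∃ i j, i ≠ j ∧ m i = m j ∧
      (∀ x, (x ∉ τ ∧ IsDominant u (insert x τ)) ↔ IsBestAbove u m i x ∨ IsBestAbove u m j x) ∧
      ∀ x, IsBestAbove u m i x → ¬ IsBestAbove u m j x := by
  classical
  obtain ⟨i, -, j, -, hij, hmij⟩ := Finset.exists_ne_map_eq_of_card_lt_of_maps_to
    (s := Finset.univ) (t := τ) (f := m) (by rw [Finset.card_univ]; omega) (fun i _ ↦ hmτ i)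
  have key : ∀ k k' x, k ≠ k' → m k = m k' → IsBestAbove u m k x →
      x ∉ τ ∧ IsDominant u (insert x τ) := by
    intro k k' x hk hmk hx
    have hsurj : ∀ z ∈ τ, ∃ l, l ≠ k ∧ m l = z := by
      intro z hz
      obtain ⟨l, hl⟩ := hτ z
      have hlz : m l = z := hu l (le_antisymm (hm l z hz) (hl _ (hmτ l)))
      by_cases hlk : l = k
      · exact ⟨k', hk.symm, by rw [← hmk, ← hlk, hlz]⟩
      · exact ⟨l, hlk, hlz⟩
    have hxk : ∀ z ∈ τ, u k x ≤ u k z := by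
      obtain ⟨l, hl⟩ := hτ x
      by_cases hlk : l = k
      · exact hlk ▸ hl
      · exact absurd (hl _ (hmτ l)) (not_le.2 (hx.1 l hlk))
    refine ⟨fun hxτ ↦ ?_, fun y ↦ ?_⟩
    · obtain ⟨l, hlk, hl⟩ := hsurj x hxτ
      exact absurd (hx.1 l hlk) (by rw [hl]; exact lt_irrefl _)
    · by_cases hy : ∀ l, l ≠ k → u l (m l) < u l y
      · refine ⟨k, fun z hz ↦ ?_⟩
        rcases Finset.mem_insert.1 hz with rfl | hz
        · exact hx.2 y hy
        · exact (hx.2 y hy).trans (hxk z hz)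
      · push Not at hy
        obtain ⟨l, hlk, hl⟩ := hy
        refine ⟨l, fun z hz ↦ ?_⟩
        rcases Finset.mem_insert.1 hz with rfl | hz
        · exact hl.trans (hx.1 l hlk).le
        · exact hl.trans (hm l z hz)
  refine ⟨i, j, hij, hmij, fun x ↦ ⟨?_, ?_⟩, ?_⟩
  · rintro ⟨hxτ, hdom⟩
    choose g hg using hdom
    have hginj : Set.InjOn g (insert x τ : Finset α) := by
      intro a ha b hb hab
      exact hu (g a) (le_antisymm (hg a b hb) (by rw [hab]; exact hg b a ha))
    have himg : (insert x τ).image g = Finset.univ := by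
      rw [← Finset.card_eq_iff_eq_univ, Finset.card_image_of_injOn hginj,
        Finset.card_insert_of_notMem hxτ, hcard]
    have hgm : ∀ l, l ≠ g x → g (m l) = l := by
      intro l hl
      have : l ∈ (insert x τ).image g := by rw [himg]; exact Finset.mem_univ _
      obtain ⟨z, hz, rfl⟩ := Finset.mem_image.1 this
      have hzτ : z ∈ τ := by
        rcases Finset.mem_insert.1 hz with rfl | h
        · exact absurd rfl hl
        · exact h
      have : m (g z) = z := hu (g z) (le_antisymm (hm _ z hzτ)
        (hg z _ (Finset.mem_insert_of_mem (hmτ _))))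
      rw [this]
    have hlt : ∀ l, l ≠ g x → u l (m l) < u l x := by
      intro l hl
      refine lt_of_le_of_ne ?_ fun h ↦ hxτ (hu l h ▸ hmτ l)
      have := hg (m l) x (Finset.mem_insert_self _ _)
      rwa [hgm l hl] at this
    have hbest : IsBestAbove u m (g x) x := by
      refine ⟨hlt, fun y hy ↦ ?_⟩
      by_cases h : g y = g x
      · rw [← h]; exact hg y x (Finset.mem_insert_self _ _)
      · exact absurd (hg y _ (Finset.mem_insert_of_mem (hmτ (g y)))) (not_le.2 (hy _ h))
    by_cases hi : i = g x
    · exact Or.inl (hi ▸ hbest)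
    by_cases hj : j = g x
    · exact Or.inr (hj ▸ hbest)
    · exact absurd (by rw [← hgm i hi, hmij, hgm j hj]) hij
  · rintro (h | h)
    · exact key i j x hij hmij h
    · exact key j i x hij.symm hmij.symm h
  · intro x hi hj
    obtain ⟨l, hl⟩ := hτ x
    have := hl _ (hmτ l)
    by_cases hli : l = i
    · exact absurd this (not_le.2 (hj.1 l (hli ▸ hij)))
    · exact absurd this (not_le.2 (hi.1 l hli))

theorem card_dominant_supersets {I α β : Type*} [LinearOrder β] [Fintype I] [Fintype α]
    [DecidableEq α] {u : I → α → β} {τ : Finset α} (hcard : τ.card + 1 = Fintype.card I)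
    (X : Finset α) (hX : ∀ x, x ∈ X ↔ x ∉ τ ∧ IsDominant u (insert x τ))
    (R : Finset (Finset α)) (hR : ∀ S, S ∈ R ↔ S.card = Fintype.card I ∧ IsDominant u S) :
    (R.filter (τ ⊆ ·)).card = X.card := by
  have : R.filter (τ ⊆ ·) = X.image (insert · τ) := by
    ext S
    simp only [Finset.mem_filter, Finset.mem_image, hR, hX]
    constructor
    · rintro ⟨⟨h1, h2⟩, h3⟩
      obtain ⟨x, hx⟩ : ∃ x, S \ τ = {x} := by
        rw [← Finset.card_eq_one, Finset.card_sdiff_of_subset h3]; omega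
      have hins : insert x τ = S := by
        rw [Finset.insert_eq, ← hx, Finset.sdiff_union_of_subset h3]
      have hxS : x ∈ S \ τ := by rw [hx]; exact Finset.mem_singleton_self x
      exact ⟨x, ⟨(Finset.mem_sdiff.1 hxS).2, by rwa [hins]⟩, hins⟩
    · rintro ⟨x, ⟨h1, h2⟩, rfl⟩
      exact ⟨⟨by rw [Finset.card_insert_of_notMem h1, hcard], h2⟩, Finset.subset_insert _ _⟩
  rw [this, Finset.card_image_of_injOn]
  intro x hx y hy hxy
  have hx' := ((hX x).1 hx).1
  have : x ∈ insert y τ := by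
    have h : insert x τ = insert y τ := hxy
    rw [← h]; exact Finset.mem_insert_self _ _
  exact (Finset.mem_insert.1 this).resolve_right hx'

theorem even_card_facets_of_image_ne_univ {I α : Type*} [Fintype I] [DecidableEq I]
    [DecidableEq α] (c : α → I) (i₀ : I) {S : Finset α} (hS : S.card = Fintype.card I)
    (hc : S.image c ≠ Finset.univ) (D : Finset (Finset α))
    (hD : ∀ τ, τ ⊆ S → (τ ∈ D ↔
      τ.card + 1 = Fintype.card I ∧ τ.image c = Finset.univ.erase i₀)) :
    Even (D.filter (· ⊆ S)).card := by
  have hpos : 0 < Fintype.card I := Fintype.card_pos_iff.2 ⟨i₀⟩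
  by_cases hne : S.image c = Finset.univ.erase i₀
  · have hcard : (S.image c).card + 1 = S.card := by
      rw [hne, Finset.card_erase_of_mem (Finset.mem_univ _), hS, Finset.card_univ]; omega
    obtain ⟨a, ha, b, hb, hab, hcab⟩ := Finset.exists_ne_map_eq_of_card_lt_of_maps_to
      (s := S) (t := S.image c) (f := c) (by omega) (fun x hx ↦ Finset.mem_image_of_mem c hx)
    have him : ∀ a ∈ S, ∀ b ∈ S, a ≠ b → c a = c b →
        (S.erase a).image c = Finset.univ.erase i₀ := by
      intro a ha b hb hab hcab
      rw [← hne]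
      refine (Finset.image_subset_image (Finset.erase_subset _ _)).antisymm fun i hi ↦ ?_
      obtain ⟨z, hz, rfl⟩ := Finset.mem_image.1 hi
      by_cases hza : z = a
      · rw [hza, hcab]
        exact Finset.mem_image_of_mem c (Finset.mem_erase.2 ⟨hab.symm, hb⟩)
      · exact Finset.mem_image_of_mem c (Finset.mem_erase.2 ⟨hza, hz⟩)
    have : D.filter (· ⊆ S) = {S.erase a, S.erase b} := by
      ext τ
      simp only [Finset.mem_filter, Finset.mem_insert, Finset.mem_singleton]
      constructor
      · rintro ⟨h1, h2⟩
        obtain ⟨h3, h4⟩ := (hD τ h2).1 h1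
        have hinj : Set.InjOn c τ := by
          rw [← Finset.card_image_iff, h4, Finset.card_erase_of_mem (Finset.mem_univ _),
            Finset.card_univ]
          omega
        obtain ⟨z, hz⟩ : ∃ z, S \ τ = {z} := by
          rw [← Finset.card_eq_one, Finset.card_sdiff_of_subset h2]; omega
        have hτ : τ = S.erase z := by
          rw [← Finset.sdiff_singleton_eq_erase, ← hz, Finset.sdiff_sdiff_eq_self h2]
        by_cases hza : z = a
        · exact Or.inl (hza ▸ hτ)
        by_cases hzb : z = b
        · exact Or.inr (hzb ▸ hτ)
        refine absurd (hinj ?_ ?_ hcab) hab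
        · rw [hτ]; exact Finset.mem_coe.2 (Finset.mem_erase.2 ⟨Ne.symm hza, ha⟩)
        · rw [hτ]; exact Finset.mem_coe.2 (Finset.mem_erase.2 ⟨Ne.symm hzb, hb⟩)
      · rintro (rfl | rfl)
        · refine ⟨(hD _ (Finset.erase_subset _ _)).2 ⟨?_, him a ha b hb hab hcab⟩,
            Finset.erase_subset _ _⟩
          rw [Finset.card_erase_of_mem ha]; omega
        · refine ⟨(hD _ (Finset.erase_subset _ _)).2 ⟨?_, him b hb a ha hab.symm hcab.symm⟩,
            Finset.erase_subset _ _⟩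
          rw [Finset.card_erase_of_mem hb]; omega
    rw [this, Finset.card_pair]
    · exact even_two
    · intro h
      have : a ∈ S.erase b := Finset.mem_erase.2 ⟨hab, ha⟩
      rw [← h] at this
      exact Finset.notMem_erase a S this
  · have : D.filter (· ⊆ S) = ∅ := by
      refine Finset.filter_eq_empty_iff.2 fun τ hτ hτS ↦ ?_
      obtain ⟨-, h4⟩ := (hD τ hτS).1 hτ
      have hsub : Finset.univ.erase i₀ ⊆ S.image c := h4 ▸ Finset.image_subset_image hτS
      by_cases hi : i₀ ∈ S.image c
      · refine hc (Finset.eq_univ_of_forall fun i ↦ ?_)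
        by_cases h : i = i₀
        · exact h ▸ hi
        · exact hsub (Finset.mem_erase.2 ⟨h, Finset.mem_univ _⟩)
      · refine hne (Finset.Subset.antisymm (fun i hi' ↦ ?_) hsub)
        exact Finset.mem_erase.2 ⟨fun h ↦ hi (h ▸ hi'), Finset.mem_univ _⟩
    rw [this]; simp

set_option maxHeartbeats 1000000 in
/-- Scarf's lemma for strict utilities: in a finite set with slack elements `s i`, every
colouring extending `s i ↦ i` admits a dominant set carrying all colours. -/
theorem exists_dominant_rainbow_of_injective {I α β : Type*} [LinearOrder β] [Fintype I]
    [Nontrivial I] [Fintype α] {u : I → α → β} (hu : ∀ i, Function.Injective (u i)) {s : I → α}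
    (hs : ∀ i x, x ≠ s i → u i (s i) < u i x)
    (hs' : ∀ i j x, j ≠ i → x ∉ Set.range s → u i x < u i (s j))
    {c : α → I} (hc : ∀ i, c (s i) = i) :
    ∃ S : Finset α, IsDominant u S ∧ ∀ i, ∃ x ∈ S, c x = i := by
  classical
  by_contra! hno
  obtain ⟨i₀⟩ : Nonempty I := inferInstance
  have hI : 1 < Fintype.card I := Fintype.one_lt_card
  have hsinj : Function.Injective s := fun i j h ↦ by rw [← hc i, h, hc j]
  set R : Finset (Finset α) :=
    Finset.univ.filter fun S ↦ S.card = Fintype.card I ∧ IsDominant u S with hRdef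
  have hR : ∀ S, S ∈ R ↔ S.card = Fintype.card I ∧ IsDominant u S := fun S ↦ by simp [hRdef]
  set D : Finset (Finset α) := Finset.univ.filter fun τ ↦ IsDominant u τ ∧
    τ.card + 1 = Fintype.card I ∧ τ.image c = Finset.univ.erase i₀ with hDdef
  have hD : ∀ τ, τ ∈ D ↔ IsDominant u τ ∧
    τ.card + 1 = Fintype.card I ∧ τ.image c = Finset.univ.erase i₀ := fun τ ↦ by simp [hDdef]
  have hdouble : ∑ S ∈ R, (D.filter (· ⊆ S)).card = ∑ τ ∈ D, (R.filter (τ ⊆ ·)).card :=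
    (Finset.sum_card_bipartiteAbove_eq_sum_card_bipartiteBelow (s := D) (t := R)
      (fun τ S : Finset α ↦ τ ⊆ S)).symm
  have heven : Even (∑ S ∈ R, (D.filter (· ⊆ S)).card) := by
    refine Finset.even_sum _ fun S hS ↦ ?_
    obtain ⟨h1, h2⟩ := (hR S).1 hS
    refine even_card_facets_of_image_ne_univ c i₀ h1 (fun h ↦ ?_) D fun τ hτ ↦ ?_
    · obtain ⟨i, hi⟩ := hno S h2
      obtain ⟨x, hx, hxi⟩ := Finset.mem_image.1 (h ▸ Finset.mem_univ i : i ∈ S.image c)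
      exact hi x hx hxi
    · rw [hD]; exact and_iff_right (h2.mono hτ)
  set τ₀ : Finset α := (Finset.univ.erase i₀).image s with hτ₀
  have hmem₀ : ∀ l, l ≠ i₀ → s l ∈ τ₀ := fun l hl ↦
    Finset.mem_image_of_mem s (Finset.mem_erase.2 ⟨hl, Finset.mem_univ _⟩)
  have hcard₀ : τ₀.card + 1 = Fintype.card I := by
    rw [hτ₀, Finset.card_image_of_injective _ hsinj,
      Finset.card_erase_of_mem (Finset.mem_univ _), Finset.card_univ]
    omega
  have hdom₀ : IsDominant u τ₀ := by
    intro y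
    by_cases hy : y ∈ Set.range s
    · obtain ⟨j, rfl⟩ := hy
      refine ⟨j, fun x _ ↦ ?_⟩
      by_cases hx : x = s j
      · rw [hx]
      · exact (hs j x hx).le
    · refine ⟨i₀, fun x hx ↦ ?_⟩
      obtain ⟨l, hl, rfl⟩ := Finset.mem_image.1 hx
      exact (hs' i₀ l y (Finset.ne_of_mem_erase hl) hy).le
  have hτ₀D : τ₀ ∈ D := by
    refine (hD _).2 ⟨hdom₀, hcard₀, ?_⟩
    rw [hτ₀, Finset.image_image, show c ∘ s = id from funext hc, Finset.image_id]
  have hmin : ∀ τ : Finset α, τ.card + 1 = Fintype.card I →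
      ∃ m : I → α, (∀ i, m i ∈ τ) ∧ ∀ i, ∀ x ∈ τ, u i (m i) ≤ u i x := by
    intro τ hτ
    have hne : τ.Nonempty := Finset.card_pos.1 (by omega)
    choose m hm using fun i ↦ Finset.exists_min_image τ (u i) hne
    exact ⟨m, fun i ↦ (hm i).1, fun i ↦ (hm i).2⟩
  have heven' : ∀ τ ∈ D.erase τ₀, Even (R.filter (τ ⊆ ·)).card := by
    intro τ hτ
    obtain ⟨hτne, hτD⟩ := Finset.mem_erase.1 hτ
    obtain ⟨hdom, hcard, himg⟩ := (hD τ).1 hτD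
    obtain ⟨m, hmτ, hm⟩ := hmin τ hcard
    obtain ⟨i, j, hij, -, hiff, hdisj⟩ := hdom.exists_insert_iff hu hcard hmτ hm
    have hslack : ∀ l k, m l = s k → k = l := by
      intro l k hlk
      by_contra hne
      refine hτne (Finset.eq_of_subset_of_card_le (fun z hz ↦ ?_) (by omega))
      by_cases hzr : z ∈ Set.range s
      · obtain ⟨r, rfl⟩ := hzr
        refine hmem₀ r (Finset.ne_of_mem_erase (?_ : r ∈ Finset.univ.erase i₀))
        rw [← himg]
        exact Finset.mem_image.2 ⟨s r, hz, hc r⟩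
      · exact absurd (hm l z hz) (not_le.2 (hlk ▸ hs' l k z hne hzr))
    have hex : ∀ k, ∃ x, IsBestAbove u m k x := by
      refine fun k ↦ exists_isBestAbove (y := s k) fun l hl ↦ ?_
      by_cases hr : m l ∈ Set.range s
      · obtain ⟨r, hr⟩ := hr
        obtain rfl := hslack l r hr.symm
        rw [← hr]
        exact hs r _ fun h ↦ hl (hsinj h).symm
      · exact hs' l k _ hl.symm hr
    obtain ⟨x, hx⟩ := hex i
    obtain ⟨y, hy⟩ := hex j
    rw [card_dominant_supersets hcard {x, y} (fun z ↦ ?_) R hR, Finset.card_pair]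
    · exact even_two
    · rintro rfl
      exact hdisj x hx hy
    · rw [hiff, Finset.mem_insert, Finset.mem_singleton]
      refine or_congr ⟨?_, fun h ↦ h.eq hu hx⟩ ⟨?_, fun h ↦ h.eq hu hy⟩
      · rintro rfl; exact hx
      · rintro rfl; exact hy
  have hone : (R.filter (τ₀ ⊆ ·)).card = 1 := by
    obtain ⟨m, hmτ, hm⟩ := hmin τ₀ hcard₀
    obtain ⟨i, j, hij, hmij, hiff, -⟩ := hdom₀.exists_insert_iff hu hcard₀ hmτ hm
    have hml : ∀ l, l ≠ i₀ → m l = s l := by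
      intro l hl
      by_contra h
      exact absurd (hm l _ (hmem₀ l hl)) (not_le.2 (hs l _ h))
    obtain ⟨x, hx⟩ : ∃ x, IsBestAbove u m i₀ x := by
      refine exists_isBestAbove (y := s i₀) fun l hl ↦ ?_
      rw [hml l hl]
      exact hs l _ fun h ↦ hl (hsinj h).symm
    have hnone : ∀ j, j ≠ i₀ → m i₀ = m j → ∀ y, ¬ IsBestAbove u m j y := by
      intro j hj hm₀ y hy
      have h₀ := hy.1 i₀ hj.symm
      rw [hm₀, hml j hj] at h₀
      by_cases hyr : y ∈ Set.range s
      · obtain ⟨r, rfl⟩ := hyr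
        by_cases hrj : r = j
        · exact lt_irrefl _ (hrj ▸ h₀)
        by_cases hr₀ : r = i₀
        · subst hr₀
          exact lt_asymm h₀ (hs r _ fun h ↦ hj (hsinj h))
        · have := hy.1 r hrj
          rw [hml r hr₀] at this
          exact lt_irrefl _ this
      · exact lt_asymm h₀ (hs' i₀ j y hj hyr)
    have hiff' : ∀ z, z ∉ τ₀ ∧ IsDominant u (insert z τ₀) ↔ IsBestAbove u m i₀ z := by
      intro z
      rw [hiff]
      by_cases hi : i = i₀
      · subst hi
        exact or_iff_left (hnone j hij.symm hmij z)
      by_cases hj : j = i₀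
      · subst hj
        exact or_iff_right (hnone i hij hmij.symm z)
      · exact absurd (hsinj (by rw [← hml i hi, hmij, hml j hj])) hij
    rw [card_dominant_supersets hcard₀ {x} (fun z ↦ ?_) R hR, Finset.card_singleton]
    rw [hiff', Finset.mem_singleton]
    refine ⟨?_, fun h ↦ h.eq hu hx⟩
    rintro rfl; exact hx
  rw [hdouble, ← Finset.add_sum_erase D _ hτ₀D, hone] at heven
  have := Finset.even_sum _ heven'
  rw [Nat.even_add] at heven
  exact Nat.not_even_one (heven.2 this)

/-- Scarf's lemma, with ties allowed. -/
theorem exists_dominant_rainbow {I α β : Type*} [LinearOrder β] [Fintype I]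
    [Nontrivial I] [Fintype α] {u : I → α → β} {s : I → α}
    (hs : ∀ i x, x ≠ s i → u i (s i) < u i x)
    (hs' : ∀ i j x, j ≠ i → x ∉ Set.range s → u i x < u i (s j))
    {c : α → I} (hc : ∀ i, c (s i) = i) :
    ∃ S : Finset α, IsDominant u S ∧ ∀ i, ∃ x ∈ S, c x = i := by
  let e := Fintype.equivFin α
  obtain ⟨S, hS, hcS⟩ := exists_dominant_rainbow_of_injective
    (u := fun i x ↦ toLex (u i x, e x)) (s := s) (c := c)
    (fun i x y h ↦ e.injective (congrArg (fun p ↦ (ofLex p).2) h))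
    (fun i x hx ↦ Prod.Lex.toLex_lt_toLex.2 (Or.inl (hs i x hx)))
    (fun i j x hj hx ↦ Prod.Lex.toLex_lt_toLex.2 (Or.inl (hs' i j x hj hx))) hc
  refine ⟨S, fun y ↦ (hS y).imp fun i hi x hx ↦ ?_, hcS⟩
  rcases Prod.Lex.toLex_le_toLex.1 (hi x hx) with h | h
  · exact h.le
  · exact h.1.le

/-- Every colouring of the grid points of a dilated simplex has nearby points `p i` such that
`p i` has colour `i`, or else lies near the `i`-th face. -/
theorem exists_close_rainbow_grid {ι : Type*} [Fintype ι] [Nontrivial ι] (N : ℕ)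
    (c : (ι → ℕ) → ι) :
    ∃ p : ι → ι → ℕ, (∀ i, ∑ l, p i l = N) ∧
      (∀ i j l, p i l ≤ p j l + Fintype.card ι) ∧
      ∀ i, c (p i) = i ∨ p i i ≤ Fintype.card ι := by
  classical
  obtain ⟨i₀⟩ : Nonempty ι := inferInstance
  let T := {x : ι → Fin (N + 1) // ∑ l, (x l : ℕ) = N}
  let u : ι → T ⊕ ι → ℕ := fun i ↦
    Sum.elim (fun x ↦ (x.1 i : ℕ) + 1) (fun j ↦ if j = i then 0 else N + 2)
  have hlift : ∀ y : ι → ℕ, ∑ l, y l = N → ∃ t : T, ∀ l, (t.1 l : ℕ) = y l := by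
    intro y hy
    have hle : ∀ l, y l < N + 1 := fun l ↦ Nat.lt_succ_of_le
      (hy ▸ Finset.single_le_sum (fun _ _ ↦ Nat.zero_le _) (Finset.mem_univ l))
    exact ⟨⟨fun l ↦ ⟨y l, hle l⟩, hy⟩, fun l ↦ rfl⟩
  obtain ⟨S, hS, hcS⟩ := exists_dominant_rainbow (u := u) (s := Sum.inr)
    (c := Sum.elim (fun x ↦ c fun l ↦ (x.1 l : ℕ)) id)
    (by
      rintro i (x | j) h
      · simp [u]
      · have : j ≠ i := fun h' ↦ h (by rw [h'])
        simp [u, this])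
    (by
      rintro i j (x | k) hj hx
      · have := (x.1 i).2
        simp only [u, Sum.elim_inl, Sum.elim_inr, if_neg hj]
        omega
      · exact absurd ⟨k, rfl⟩ hx)
    (fun i ↦ rfl)
  obtain ⟨t₀, ht₀⟩ : ∃ t : T, Sum.inl t ∈ S := by
    by_contra! h
    have hall : ∀ i, (Sum.inr i : T ⊕ ι) ∈ S := by
      intro i
      obtain ⟨x | j, hx, hxi⟩ := hcS i
      · exact absurd hx (h x)
      · obtain rfl : j = i := hxi
        exact hx
    obtain ⟨t, -⟩ := hlift (Pi.single i₀ N) (by simp)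
    obtain ⟨i, hi⟩ := hS (Sum.inl t)
    have := hi _ (hall i)
    simp [u] at this
  let k : ι → ℕ := fun i ↦ S.inf' ⟨_, ht₀⟩ (u i)
  have hk : ∀ i, ∀ x ∈ S, k i ≤ u i x := fun i x hx ↦ Finset.inf'_le _ hx
  have hksum : N < ∑ i, k i := by
    by_contra! hle
    obtain ⟨t, ht⟩ := hlift (fun l ↦ k l + if l = i₀ then N - ∑ i, k i else 0) (by
      rw [Finset.sum_add_distrib, Finset.sum_ite_eq' Finset.univ i₀]
      simp only [Finset.mem_univ, if_true]
      omega)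
    obtain ⟨i, hi⟩ := hS (Sum.inl t)
    obtain ⟨x, hx, hxi⟩ := Finset.exists_mem_eq_inf' ⟨_, ht₀⟩ (u i)
    have h1 : (t.1 i : ℕ) + 1 ≤ u i x := hi x hx
    have h2 : k i = u i x := hxi
    have h3 := ht i
    omega
  have hclose : ∀ t : T, Sum.inl t ∈ S → ∀ l,
      k l ≤ (t.1 l : ℕ) + 1 ∧ (t.1 l : ℕ) + 1 < k l + Fintype.card ι := by
    intro t ht
    have hkt : ∀ l, k l ≤ (t.1 l : ℕ) + 1 := fun l ↦ hk l _ ht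
    refine fun l ↦ ⟨hkt l, ?_⟩
    have h1 : ∑ l, ((t.1 l : ℕ) + 1 - k l) + ∑ l, k l = N + Fintype.card ι := by
      rw [← Finset.sum_add_distrib, Finset.sum_congr rfl fun l _ ↦ Nat.sub_add_cancel (hkt l),
        Finset.sum_add_distrib, t.2]
      simp
    have h2 : (t.1 l : ℕ) + 1 - k l ≤ ∑ l, ((t.1 l : ℕ) + 1 - k l) :=
      Finset.single_le_sum (f := fun l ↦ (t.1 l : ℕ) + 1 - k l) (fun _ _ ↦ Nat.zero_le _)
        (Finset.mem_univ l)
    have h3 := hkt l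
    omega
  have hex : ∀ i, ∃ t : T, Sum.inl t ∈ S ∧
      (c (fun l ↦ (t.1 l : ℕ)) = i ∨ (t.1 i : ℕ) ≤ Fintype.card ι) := by
    intro i
    obtain ⟨t | j, hx, hxi⟩ := hcS i
    · exact ⟨t, hx, Or.inl hxi⟩
    · obtain rfl : j = i := hxi
      have h1 := hk j _ hx
      have h2 := (hclose t₀ ht₀ j).2
      simp only [u, Sum.elim_inr, if_true] at h1
      exact ⟨t₀, ht₀, Or.inr (by omega)⟩
  choose t ht hct using hex
  refine ⟨fun i l ↦ ((t i).1 l : ℕ), fun i ↦ (t i).2, fun i j l ↦ ?_, hct⟩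
  have h1 := hclose _ (ht i) l
  have h2 := hclose _ (ht j) l
  dsimp only
  omega

/-- Brouwer's fixed point theorem for the standard simplex. -/
theorem exists_fixedPoint_stdSimplex {ι : Type*} [Fintype ι] [Nonempty ι]
    {f : (ι → ℝ) → ι → ℝ} (hf : ContinuousOn f (stdSimplex ℝ ι))
    (hmaps : MapsTo f (stdSimplex ℝ ι) (stdSimplex ℝ ι)) :
    ∃ x ∈ stdSimplex ℝ ι, f x = x := by
  classical
  rcases subsingleton_or_nontrivial ι with hsub | hnt
  · obtain ⟨i₀⟩ : Nonempty ι := inferInstance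
    have huniq : ∀ x ∈ stdSimplex ℝ ι, ∀ i, x i = 1 := by
      intro x hx i
      rw [← hx.2, Fintype.sum_subsingleton x i]
    have hmem := single_mem_stdSimplex ℝ i₀
    exact ⟨_, hmem, funext fun i ↦ by rw [huniq _ (hmaps hmem), huniq _ hmem]⟩
  obtain ⟨i₀⟩ : Nonempty ι := inferInstance
  let q : ℕ → (ι → ℕ) → ι → ℝ := fun N x l ↦ (x l : ℝ) / (N + 1)
  have hq : ∀ N x, ∑ l, x l = N + 1 → q N x ∈ stdSimplex ℝ ι := by
    intro N x hx
    refine ⟨fun l ↦ by positivity, ?_⟩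
    have : (∑ l, (x l : ℝ)) = N + 1 := by exact_mod_cast hx
    simp only [q, ← Finset.sum_div, this]
    exact div_self (by positivity)
  have hcol : ∀ N x, ∃ i, ∑ l, x l = N + 1 → q N x i ≤ f (q N x) i := by
    intro N x
    by_cases hx : ∑ l, x l = N + 1
    · obtain ⟨i, -, hi⟩ := Finset.exists_le_of_sum_le (s := Finset.univ)
        Finset.univ_nonempty ((hq N x hx).2.trans (hmaps (hq N x hx)).2.symm).le
      exact ⟨i, fun _ ↦ hi⟩
    · exact ⟨i₀, fun h ↦ absurd h hx⟩
  choose c hc using hcol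
  choose p hpsum hpclose hpc using fun N ↦ exists_close_rainbow_grid (N + 1) (c N)
  let r : ℕ → ℝ := fun N ↦ (Fintype.card ι : ℝ) * (1 / ((N : ℝ) + 1))
  have hr : Tendsto r atTop (𝓝 0) := by
    simpa [r] using tendsto_one_div_add_atTop_nhds_zero_nat.const_mul (Fintype.card ι : ℝ)
  have hmem : ∀ N i, q N (p N i) ∈ stdSimplex ℝ ι := fun N i ↦ hq N _ (hpsum N i)
  have hqle : ∀ N i j l, q N (p N i) l ≤ q N (p N j) l + r N := by
    intro N i j l
    have : (p N i l : ℝ) ≤ p N j l + Fintype.card ι := by exact_mod_cast hpclose N i j l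
    have hN : (0 : ℝ) < N + 1 := by positivity
    simp only [q, r, mul_one_div, ← add_div]
    gcongr
  have hqf : ∀ N i, q N (p N i) i ≤ f (q N (p N i)) i + r N := by
    intro N i
    have hN : (0 : ℝ) < N + 1 := by positivity
    rcases hpc N i with h | h
    · have h1 := hc N (p N i) (hpsum N i)
      rw [h] at h1
      have : 0 ≤ r N := by positivity
      linarith
    · have h1 := (hmaps (hmem N i)).1 i
      have h2 : q N (p N i) i ≤ r N := by
        simp only [q, r, mul_one_div]
        gcongr
      linarith
  obtain ⟨x, hx, φ, hφ, hlim⟩ := (isCompact_stdSimplex ℝ ι).tendsto_subseq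
    (fun N ↦ hmem N i₀)
  have hrφ := hr.comp hφ.tendsto_atTop
  have hlim' : ∀ i, Tendsto (fun N ↦ q (φ N) (p (φ N) i)) atTop (𝓝 x) := by
    intro i
    refine tendsto_pi_nhds.2 fun l ↦ ?_
    have hl := tendsto_pi_nhds.1 hlim l
    refine tendsto_of_tendsto_of_tendsto_of_le_of_le (by simpa using hl.sub hrφ)
      (by simpa using hl.add hrφ) (fun N ↦ ?_) (fun N ↦ ?_)
    · have := hqle (φ N) i₀ i l
      simp only
      linarith
    · exact hqle (φ N) i i₀ l
  have hle : ∀ i, x i ≤ f x i := by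
    intro i
    have h1 := tendsto_pi_nhds.1 (hlim' i) i
    have h2 : Tendsto (fun N ↦ f (q (φ N) (p (φ N) i))) atTop (𝓝 (f x)) :=
      (hf x hx).tendsto.comp (tendsto_nhdsWithin_iff.2
        ⟨hlim' i, Eventually.of_forall fun N ↦ hmem (φ N) i⟩)
    have h3 := (tendsto_pi_nhds.1 h2 i).add hrφ
    rw [add_zero] at h3
    exact le_of_tendsto_of_tendsto' h1 h3 fun N ↦ hqf (φ N) i
  refine ⟨x, hx, funext fun i ↦ ?_⟩
  have := (Finset.sum_eq_sum_iff_of_le (s := Finset.univ) fun i _ ↦ hle i).1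
    (hx.2.trans (hmaps hx).2.symm)
  exact (this i (Finset.mem_univ i)).symm

/-- An arbitrary self-map of a compact convex set has, at every scale `ε`, a point lying in the
convex hull of the values taken within distance `ε` of it. -/
theorem exists_mem_convexHull_image_ball {E : Type*} [NormedAddCommGroup E] [NormedSpace ℝ E]
    {A : Set E} (hcomp : IsCompact A) (hconv : Convex ℝ A) (hne : A.Nonempty) {f : E → E}
    (hf : MapsTo f A A) {ε : ℝ} (hε : 0 < ε) :
    ∃ x ∈ A, x ∈ convexHull ℝ (f '' (A ∩ Metric.ball x ε)) := by
  obtain ⟨t, htA, hcover⟩ := hcomp.elim_nhds_subcover (fun y ↦ Metric.ball y ε)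
    fun y _ ↦ Metric.ball_mem_nhds y hε
  have hφpos : ∀ x ∈ A, 0 < ∑ y : t, max 0 (ε - dist x y) := by
    intro x hx
    obtain ⟨y, hy, hxy⟩ := mem_iUnion₂.1 (hcover hx)
    refine Finset.sum_pos' (fun _ _ ↦ le_max_left _ _) ⟨⟨y, hy⟩, Finset.mem_univ _, ?_⟩
    exact lt_max_of_lt_right (sub_pos.2 hxy)
  obtain ⟨a, ha⟩ := hne
  have : Nonempty t := by
    obtain ⟨y, hy, -⟩ := mem_iUnion₂.1 (hcover ha)
    exact ⟨⟨y, hy⟩⟩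
  let g : (t → ℝ) → E := fun w ↦ ∑ y, w y • f y
  have hg : Continuous g := by fun_prop
  have hgA : ∀ w ∈ stdSimplex ℝ t, g w ∈ A := fun w hw ↦
    hconv.sum_mem (fun y _ ↦ hw.1 y) hw.2 fun y _ ↦ hf (htA y y.2)
  obtain ⟨w, hw, hfix⟩ := exists_fixedPoint_stdSimplex
    (f := fun w y ↦ max 0 (ε - dist (g w) y) / ∑ z : t, max 0 (ε - dist (g w) z))
    (by
      refine continuousOn_pi.2 fun y ↦ ContinuousOn.div (by fun_prop) (by fun_prop) ?_
      exact fun w hw ↦ (hφpos _ (hgA w hw)).ne')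
    (by
      intro w hw
      have hpos := hφpos _ (hgA w hw)
      refine ⟨fun y ↦ div_nonneg (le_max_left _ _) hpos.le, ?_⟩
      rw [← Finset.sum_div]
      exact div_self hpos.ne')
  refine ⟨g w, hgA w hw, ?_⟩
  have hsum : ∑ y with w y ≠ 0, w y = 1 := by
    rw [Finset.sum_filter_ne_zero, hw.2]
  have hgw : g w = ∑ y with w y ≠ 0, w y • f y := by
    rw [Finset.sum_filter_of_ne]
    intro y _ h h0
    exact h (by rw [h0, zero_smul])
  suffices ∑ y with w y ≠ 0, w y • f y ∈ convexHull ℝ (f '' (A ∩ Metric.ball (g w) ε)) by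
    rwa [← hgw] at this
  refine (convex_convexHull ℝ _).sum_mem (fun y _ ↦ hw.1 y) hsum fun y hy ↦
    subset_convexHull ℝ _ ⟨y, ⟨htA y y.2, ?_⟩, rfl⟩
  rw [Metric.mem_ball']
  by_contra! hle
  refine (Finset.mem_filter.1 hy).2 ?_
  rw [← congrFun hfix y, max_eq_left (sub_nonpos.2 hle), zero_div]

/-- If near every point the values of `f` stay within any `r > d` of the value at the point, then
some point is displaced by at most `d`. -/
theorem exists_norm_sub_le_of_locally_norm_sub_le {E : Type*} [NormedAddCommGroup E]
    [NormedSpace ℝ E] {A : Set E} (hcomp : IsCompact A) (hconv : Convex ℝ A) (hne : A.Nonempty)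
    {f : E → E} (hf : MapsTo f A A) {d : ℝ}
    (hd : ∀ p ∈ A, ∀ r > d, ∃ δ > 0, ∀ q ∈ A, ‖q - p‖ < δ → ‖f p - f q‖ ≤ r) :
    ∃ p ∈ A, ‖f p - p‖ ≤ d := by
  choose x hxA hx using fun k : ℕ ↦ exists_mem_convexHull_image_ball hcomp hconv hne hf
    (Nat.one_div_pos_of_nat (n := k) : (0 : ℝ) < 1 / (k + 1))
  obtain ⟨p, hp, φ, hφ, hlim⟩ := hcomp.tendsto_subseq hxA
  refine ⟨p, hp, le_of_forall_gt_imp_ge_of_dense fun r hr ↦ ?_⟩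
  obtain ⟨δ, hδ, hball⟩ := hd p hp r hr
  have hev : ∀ᶠ k in atTop, x (φ k) ∈ Metric.closedBall (f p) r := by
    have h1 := (tendsto_iff_dist_tendsto_zero.1 hlim).add
      (tendsto_one_div_add_atTop_nhds_zero_nat (𝕜 := ℝ) |>.comp hφ.tendsto_atTop)
    rw [add_zero] at h1
    filter_upwards [h1.eventually_lt_const hδ] with k hk
    refine convexHull_min ?_ (convex_closedBall (f p) r) (hx (φ k))
    rintro _ ⟨q, ⟨hqA, hq⟩, rfl⟩
    rw [Metric.mem_closedBall', dist_eq_norm]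
    refine hball q hqA ?_
    rw [← dist_eq_norm]
    rw [Metric.mem_ball] at hq
    have := dist_triangle q (x (φ k)) p
    simp only [Function.comp] at hk
    linarith
  have := Metric.isClosed_closedBall.mem_of_tendsto hlim hev
  rwa [Metric.mem_closedBall', dist_eq_norm] at this

/-- Cromme–Diener approximate fixed point theorem: for `A` a compact convex
subset of `ℝⁿ` with at least two points and `f : A → A` any map, there is a
point `p* ∈ A` with `‖f(p*) - p*‖ ≤ d(f)`, where
`d(f) = sup_{p ∈ A} inf_{δ > 0} sup {‖f(p) - f(q)‖ : q ∈ A, 0 < ‖q - p‖ < δ}`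
is the measure of discontinuity of `f`. -/
theorem exists_dist_le_measure_of_discontinuity {n : ℕ}
    (A : Set (EuclideanSpace ℝ (Fin n)))
    (hcomp : IsCompact A) (hconv : Convex ℝ A)
    (htwo : ∃ a ∈ A, ∃ b ∈ A, a ≠ b)
    (f : EuclideanSpace ℝ (Fin n) → EuclideanSpace ℝ (Fin n))
    (hf : Set.MapsTo f A A) :
    ∃ pstar ∈ A,
      ‖f pstar - pstar‖ ≤
        ⨆ p : A, ⨅ δ : Set.Ioi (0 : ℝ),
          ⨆ q : {q : EuclideanSpace ℝ (Fin n) //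
              q ∈ A ∧ 0 < ‖q - (p : EuclideanSpace ℝ (Fin n))‖ ∧
                ‖q - (p : EuclideanSpace ℝ (Fin n))‖ < (δ : ℝ)},
            ‖f p - f q‖ := by
  obtain ⟨a, ha, -⟩ := htwo
  obtain ⟨D, hD⟩ := Metric.isBounded_iff.1 hcomp.isBounded
  have hfD : ∀ p ∈ A, ∀ q ∈ A, ‖f p - f q‖ ≤ D := fun p hp q hq ↦ by
    rw [← dist_eq_norm]; exact hD (hf hp) (hf hq)
  have hD0 : 0 ≤ D := (norm_nonneg _).trans (hfD a ha a ha)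
  refine exists_norm_sub_le_of_locally_norm_sub_le hcomp hconv ⟨a, ha⟩ hf fun p hp r hr ↦ ?_
  have hbdd : BddAbove (range fun p : A ↦ ⨅ δ : Set.Ioi (0 : ℝ),
      ⨆ q : {q : EuclideanSpace ℝ (Fin n) //
          q ∈ A ∧ 0 < ‖q - (p : EuclideanSpace ℝ (Fin n))‖ ∧
            ‖q - (p : EuclideanSpace ℝ (Fin n))‖ < (δ : ℝ)}, ‖f p - f q‖) := by
    refine ⟨D, ?_⟩
    rintro _ ⟨p, rfl⟩
    refine ciInf_le_of_le ⟨0, ?_⟩ ⟨1, mem_Ioi.2 one_pos⟩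
      (Real.iSup_le (fun q ↦ hfD p p.2 q q.2.1) hD0)
    rintro _ ⟨δ, rfl⟩
    exact Real.iSup_nonneg fun q ↦ norm_nonneg _
  have : Nonempty (Set.Ioi (0 : ℝ)) := ⟨⟨1, mem_Ioi.2 one_pos⟩⟩
  obtain ⟨⟨δ, hδ⟩, hlt⟩ := exists_lt_of_ciInf_lt ((le_ciSup hbdd ⟨p, hp⟩).trans_lt hr)
  have hd0 : 0 ≤ r := (Real.iSup_nonneg fun q ↦ norm_nonneg _).trans hlt.le
  refine ⟨δ, hδ, fun q hq hqp ↦ ?_⟩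
  rcases eq_or_ne q p with rfl | hne
  · simpa using hd0
  · refine (le_ciSup (f := fun q : {q : EuclideanSpace ℝ (Fin n) //
      q ∈ A ∧ 0 < ‖q - p‖ ∧ ‖q - p‖ < δ} ↦ ‖f p - f q‖) ⟨D, ?_⟩
      ⟨q, hq, norm_pos_iff.2 (sub_ne_zero.2 hne), hqp⟩).trans hlt.le
    rintro _ ⟨z, rfl⟩
    exact hfD p hp z z.2.1
end
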